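/- arXiv:1309.2567 — 2 statements merged into one kernel-verified Lean document; each statement's English description precedes it below -/
import Mathlib

section
/- (Strong Laurent Phenomenon) For every m ∈ ℤ one has A(P1,P2) = ⋂_{k∈ℤ} T_k = T_{m−1} ∩ T_m ∩ T_{m+1}; in particular an element of F is contained in A(P1,P2) if and only if it lies in T_{m−1}, T_m and T_{m+1} for any (equivalently, some) three consecutive clusters. -/
open Polynomial
noncomputable section

namespace GCA

/-- The ambient field of rational functions in two variables over `K`. -/
abbrev F (K : Type*) [Field K] := FractionRing (MvPolynomial (Fin 2) K)

/-- The canonical embedding of `K` into `F K`. -/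
def φ (K : Type*) [Field K] : K →+* F K :=
  (algebraMap (MvPolynomial (Fin 2) K) (F K)).comp (MvPolynomial.C)

/-- The two variables `x1, x2` in `F K`. -/
def Xv (K : Type*) [Field K] (i : Fin 2) : F K :=
  algebraMap (MvPolynomial (Fin 2) K) (F K) (MvPolynomial.X i)

/-- A polynomial of degree `d` is palindromic if `P(z) = z^d P(1/z)`. -/
def Palindromic {K : Type*} [Field K] (P : K[X]) : Prop :=
  ∀ t ≤ P.natDegree, P.coeff t = P.coeff (P.natDegree - t)

/-- `x : ℤ → F K` is the sequence of cluster variables for the exchange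
polynomials `P1, P2`. -/
def ClusterSeq {K : Type*} [Field K] (P1 P2 : K[X]) (x : ℤ → F K) : Prop :=
  x 1 = Xv K 0 ∧ x 2 = Xv K 1 ∧ (∀ k, x k ≠ 0) ∧
    ∀ k : ℤ, x (k + 1) * x (k - 1) =
      if Even k then Polynomial.eval₂ (φ K) (x k) P1 else Polynomial.eval₂ (φ K) (x k) P2

/-- `underline-K`: the ℤ-subalgebra (subring) of `K` generated by the coefficients
of `P1` and `P2`. -/
def uK {K : Type*} [Field K] (P1 P2 : K[X]) : Subring K :=
  Subring.closure (Set.range P1.coeff ∪ Set.range P2.coeff)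

/-- The generalized cluster algebra `A(P1,P2)`: the `uK`-subalgebra of `F K`
generated by the cluster variables, as a subring of `F K`. -/
def clA {K : Type*} [Field K] (P1 P2 : K[X]) (x : ℤ → F K) : Subring (F K) :=
  Subring.closure (φ K '' (uK P1 P2 : Set K) ∪ Set.range x)

/-- The Laurent polynomial ring `T k` in the cluster `{x k, x (k+1)}`. -/
def clT {K : Type*} [Field K] (P1 P2 : K[X]) (x : ℤ → F K) (k : ℤ) : Subring (F K) :=
  Subring.closure (φ K '' (uK P1 P2 : Set K) ∪ {x k, (x k)⁻¹, x (k + 1), (x (k + 1))⁻¹})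

/-- The standard monomial `z_k[a1,a2]`. -/
def zmon {K : Type*} [Field K] (x : ℤ → F K) (k a1 a2 : ℤ) : F K :=
  x (k - 1) ^ (max a2 0).toNat * x k ^ (max (-a1) 0).toNat *
    x (k + 1) ^ (max (-a2) 0).toNat * x (k + 2) ^ (max a1 0).toNat

/-- `y` is pointed at `(a1, a2)` with coefficient function `c`. -/
def PointedAt {K : Type*} [Field K] (P1 P2 : K[X]) (x : ℤ → F K) (a1 a2 : ℤ)
    (c : ℕ × ℕ →₀ K) (y : F K) : Prop :=
  (∀ m, c m ∈ uK P1 P2) ∧ c (0, 0) = 1 ∧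
    y = x 1 ^ (-a1) * x 2 ^ (-a2) *
      ∑ m ∈ c.support, φ K (c m) * x 1 ^ m.1 * x 2 ^ m.2

open scoped IntermediateField

open scoped IntermediateField.algebraAdjoinAdjoin in
/-- A pair `a, b` is algebraically independent iff `a` is transcendental over `K` and `b` is
transcendental over `K(a)`. -/
theorem algebraicIndependent_pair_iff {K E : Type*} [Field K] [Field E] [Algebra K E] {a b : E} :
    AlgebraicIndependent K ![a, b] ↔ Transcendental K a ∧ Transcendental K⟮a⟯ b := by
  have hs : ({1}ᶜ : Set (Fin 2)) = {0} := by ext i; fin_cases i <;> simp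
  have : Unique {j : Fin 2 // j ≠ 1} :=
    ⟨⟨⟨0, by decide⟩⟩, fun j => Subtype.ext <| by
      have := j.2
      change (j : Fin 2) = 0
      omega⟩
  have hd : ((default : {j : Fin 2 // j ≠ 1}) : Fin 2) = 0 := by
    rw [Unique.default_eq (⟨0, by decide⟩ : {j : Fin 2 // j ≠ 1})]
  rw [AlgebraicIndependent.iff_transcendental_adjoin_image 1, algebraicIndependent_unique_type_iff,
    hd, hs, Set.image_singleton]
  simp only [Matrix.cons_val_zero, Matrix.cons_val_one]
  have : IsDomain (Algebra.adjoin K {a}) := inferInstance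
  refine and_congr_right fun _ => not_congr ?_
  exact IsFractionRing.isAlgebraic_iff (Algebra.adjoin K {a}) K⟮a⟯ E

theorem algebraicIndependent_pair_comm {K E : Type*} [Field K] [Field E] [Algebra K E] {a b : E} :
    AlgebraicIndependent K ![a, b] ↔ AlgebraicIndependent K ![b, a] := by
  refine (algebraicIndependent_equiv' (Equiv.swap 0 1) ?_)
  ext i; fin_cases i <;> simp

/-- If `a, b` are algebraically independent then so are `b, c`, where `a * c` is a nonzero element
of `K(b)`. -/
theorem algebraicIndependent_pair_exchange {K E : Type*} [Field K] [Field E] [Algebra K E]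
    {a b c : E} (h : AlgebraicIndependent K ![a, b]) (hc : c * a ∈ K⟮b⟯) (hc0 : c * a ≠ 0) :
    AlgebraicIndependent K ![b, c] := by
  rw [algebraicIndependent_pair_comm, algebraicIndependent_pair_iff] at h
  rw [algebraicIndependent_pair_iff]
  refine ⟨h.1, fun hcalg => h.2 ?_⟩
  have : a = c * a * c⁻¹ := by
    rw [mul_right_comm, mul_inv_cancel₀ (left_ne_zero_of_mul hc0), one_mul]
  rw [this]
  exact (isAlgebraic_algebraMap (⟨_, hc⟩ : K⟮b⟯)).mul hcalg.inv

theorem linearIndependent_zpow {L E : Type*} [Field L] [Field E] [Algebra L E] {b : E}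
    (hb : Transcendental L b) : LinearIndependent L (fun n : ℤ => b ^ n) := by
  have hb0 : b ≠ 0 := by rintro rfl; exact hb isAlgebraic_zero
  rw [linearIndependent_iff']
  intro s g hg i hi
  obtain ⟨N, hN⟩ : ∃ N : ℕ, ∀ i ∈ s, 0 ≤ i + N := by
    refine ⟨∑ i ∈ s, i.natAbs, fun i hi => ?_⟩
    have := Finset.single_le_sum (f := fun i : ℤ => i.natAbs) (fun _ _ => Nat.zero_le _) hi
    omega
  set p : L[X] := ∑ j ∈ s, monomial (j + N).toNat (g j) with hp
  have hp0 : p = 0 := by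
    refine (transcendental_iff.1 hb) p ?_
    have : aeval b p = (∑ j ∈ s, g j • b ^ j) * b ^ N := by
      rw [hp, map_sum, Finset.sum_mul]
      refine Finset.sum_congr rfl fun j hj => ?_
      rw [aeval_monomial, Algebra.smul_def, mul_assoc, ← zpow_natCast, ← zpow_natCast,
        ← zpow_add₀ hb0, Int.toNat_of_nonneg (hN j hj)]
    rw [this, hg, zero_mul]
  have := congrArg (fun q => q.coeff (i + N).toNat) hp0
  simp only [hp, finsetSum_coeff, coeff_monomial, coeff_zero] at this
  rw [Finset.sum_eq_single_of_mem i hi] at this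
  · simpa using this
  · intro j hj hji
    have h1 := hN i hi
    have h2 := hN j hj
    rw [if_neg (by omega)]

theorem eq_zero_of_sum_mul_zpow_eq_zero {K E : Type*} [Field K] [Field E] [Algebra K E]
    {L : IntermediateField K E} {b : E} (hb : Transcendental L b) {s : Finset ℤ} {c : ℤ → E}
    (hc : ∀ n, c n ∈ L) (h : ∑ i ∈ s, c i * b ^ i = 0) : ∀ i ∈ s, c i = 0 := by
  lift c to ℤ → L using hc
  have hli := linearIndependent_zpow hb
  rw [linearIndependent_iff'] at hli
  intro i hi
  exact congrArg Subtype.val (hli s c h i hi)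

/-- Uniqueness of coefficients when a Laurent polynomial in `b` is also a Laurent polynomial
in `q / b`. -/
theorem coeff_neg_eq_of_sum_zpow_eq {K E : Type*} [Field K] [Field E] [Algebra K E]
    {L : IntermediateField K E} {b q : E} (hb : Transcendental L b) (hq : q ∈ L) {f g : ℤ →₀ E}
    (hf : ∀ n, f n ∈ L) (hg : ∀ n, g n ∈ L)
    (h : (f.sum fun n c => c * b ^ n) = g.sum fun n c => c * (q / b) ^ n) (n : ℤ) :
    f (-n) = q ^ n * g n := by
  classical
  obtain ⟨s, hs⟩ : ∃ s : Finset ℤ, s = f.support ∪ g.support.map (Equiv.neg ℤ).toEmbedding :=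
    ⟨_, rfl⟩
  have hfs : (f.sum fun n c => c * b ^ n) = ∑ i ∈ s, f i * b ^ i :=
    Finsupp.sum_of_support_subset _ (hs ▸ Finset.subset_union_left) _ (by simp)
  have hgs : (g.sum fun n c => c * (q / b) ^ n) = ∑ i ∈ s, q ^ (-i) * g (-i) * b ^ i := by
    rw [Finsupp.sum_of_support_subset g (s := s.map (Equiv.neg ℤ).toEmbedding) _ _ (by simp),
      Finset.sum_map]
    · refine Finset.sum_congr rfl fun i _ => ?_
      simp only [Equiv.coe_toEmbedding, Equiv.neg_apply, div_zpow, zpow_neg, inv_div]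
      ring
    · intro i hi
      simp only [Finset.mem_map_equiv, hs, Finset.mem_union]
      right
      simpa using hi
  have hzero := eq_zero_of_sum_mul_zpow_eq_zero hb (s := s)
    (c := fun i => f i - q ^ (-i) * g (-i))
    (fun i => sub_mem (hf i) (mul_mem (zpow_mem hq _) (hg _)))
    (by simp only [sub_mul]; rw [Finset.sum_sub_distrib, ← hfs, ← hgs, h, sub_self])
  by_cases hn : -n ∈ s
  · have := hzero _ hn
    simpa [sub_eq_zero] using this
  · simp only [hs, Finset.mem_union, Finset.mem_map_equiv, Finsupp.mem_support_iff, not_or,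
      not_not] at hn
    have h2 : g n = 0 := by simpa using hn.2
    rw [hn.1, h2, mul_zero]

/-- Elements of `B[b, b⁻¹]` are Laurent polynomials in `b`. -/
theorem exists_sum_zpow {E : Type*} [Field E] (B : Subring E) {b y : E}
    (hb : b ≠ 0) (hy : y ∈ Subring.closure (B ∪ {b, b⁻¹} : Set E)) :
    ∃ f : ℤ →₀ E, (∀ n, f n ∈ B) ∧ y = f.sum fun n c => c * b ^ n := by
  classical
  let ev : LaurentPolynomial B →+* E := LaurentPolynomial.eval₂ B.subtype (Units.mk0 b hb)
  have hle : Subring.closure (B ∪ {b, b⁻¹} : Set E) ≤ ev.range := by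
    rw [Subring.closure_le]
    rintro z (hz | rfl | rfl)
    · exact ⟨LaurentPolynomial.C ⟨z, hz⟩, by simp [ev]⟩
    · exact ⟨LaurentPolynomial.T 1, by simp [ev]⟩
    · exact ⟨LaurentPolynomial.T (-1), by simp [ev]⟩
  obtain ⟨p, rfl⟩ := hle hy
  clear hy
  induction p using LaurentPolynomial.induction_on' with
  | add p q hp hq =>
    obtain ⟨f, hf, hpf⟩ := hp
    obtain ⟨g, hg, hqg⟩ := hq
    refine ⟨f + g, fun n => add_mem (hf n) (hg n), ?_⟩
    rw [map_add, hpf, hqg, Finsupp.sum_add_index' (by simp) (fun _ _ _ => add_mul _ _ _)]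
  | C_mul_T n a =>
    refine ⟨Finsupp.single n a, fun m => ?_, ?_⟩
    · rw [Finsupp.single_apply]
      split_ifs
      exacts [a.2, B.zero_mem]
    · simp [ev]

theorem exists_pow_mul_mem_closure {E : Type*} [Field E] {S : Set E} {a c : E} (ha : a ≠ 0)
    (hc : c ∈ Subring.closure (S ∪ {a, a⁻¹})) : ∃ k : ℕ, a ^ k * c ∈ Subring.closure (S ∪ {a}) := by
  have hmem : a ∈ Subring.closure (S ∪ {a}) := Subring.subset_closure (by simp)
  induction hc using Subring.closure_induction with
  | mem x hx =>
    obtain hx | rfl | rfl := hx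
    · exact ⟨0, by simpa using (Subring.subset_closure (Or.inl hx) : x ∈ Subring.closure (S ∪ {a}))⟩
    · exact ⟨0, by simpa using hmem⟩
    · exact ⟨1, by simp [ha, one_mem]⟩
  | zero => exact ⟨0, by simp [zero_mem]⟩
  | one => exact ⟨0, by simp [one_mem]⟩
  | add x y _ _ hx hy =>
    obtain ⟨k, hk⟩ := hx
    obtain ⟨l, hl⟩ := hy
    refine ⟨k + l, ?_⟩
    have : a ^ (k + l) * (x + y) = a ^ l * (a ^ k * x) + a ^ k * (a ^ l * y) := by ring
    rw [this]
    exact add_mem (mul_mem (pow_mem hmem l) hk) (mul_mem (pow_mem hmem k) hl)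
  | neg x _ hx =>
    obtain ⟨k, hk⟩ := hx
    exact ⟨k, by simpa using hk⟩
  | mul x y _ _ hx hy =>
    obtain ⟨k, hk⟩ := hx
    obtain ⟨l, hl⟩ := hy
    refine ⟨k + l, ?_⟩
    have : a ^ (k + l) * (x * y) = (a ^ k * x) * (a ^ l * y) := by ring
    rw [this]
    exact mul_mem hk hl

/-- Powers of `1 - e` are invertible modulo every power of `e`. -/
theorem exists_pow_mul_eq_one_sub {E : Type*} [CommRing E] {C : Subring E} {e : E} (he : e ∈ C)
    (k n : ℕ) : ∃ w ∈ C, ∃ σ ∈ C, ((1 - e) * w) ^ k = 1 - e ^ n * σ := by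
  refine ⟨∑ i ∈ Finset.range n, e ^ i, sum_mem fun i _ => pow_mem he i, ?_⟩
  rw [mul_neg_geom_sum]
  induction k with
  | zero => exact ⟨0, zero_mem _, by simp⟩
  | succ k ih =>
    obtain ⟨σ, hσ, h⟩ := ih
    refine ⟨σ + 1 - e ^ n * σ, sub_mem (add_mem hσ (one_mem _)) (mul_mem (pow_mem he n) hσ), ?_⟩
    rw [pow_succ, h]
    ring

/-- The intersection of the Laurent polynomial rings of three consecutive clusters is contained
in the ring generated by the four cluster variables involved. -/
theorem mem_closure_of_mem_three_clusters {K E : Type*} [Field K] [Field E] [Algebra K E]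
    {R : Subring E} (hR : ∀ r ∈ R, r ∈ (algebraMap K E).range) {a b a' b' p s y : E}
    (hab : AlgebraicIndependent K ![a, b]) (hb' : b' ≠ 0) (ha' : a' ≠ 0)
    (hp : p ∈ Subring.closure (R ∪ {a} : Set E)) (hbp : b' * b = p)
    (hs : s ∈ Subring.closure (R ∪ {b} : Set E)) (haq : a' * a = 1 + b * s)
    (hle : Subring.closure (R ∪ {b', a, b, a'} : Set E) ≤
      Subring.closure (R ∪ {b, b⁻¹, a', a'⁻¹} : Set E))
    (h₁ : y ∈ Subring.closure (R ∪ {b', b'⁻¹, a, a⁻¹} : Set E))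
    (h₂ : y ∈ Subring.closure (R ∪ {a, a⁻¹, b, b⁻¹} : Set E))
    (h₃ : y ∈ Subring.closure (R ∪ {b, b⁻¹, a', a'⁻¹} : Set E)) :
    y ∈ Subring.closure (R ∪ {b', a, b, a'} : Set E) := by
  obtain ⟨haK, hb⟩ := algebraicIndependent_pair_iff.1 hab
  obtain ⟨hbK, ha⟩ := algebraicIndependent_pair_iff.1 (algebraicIndependent_pair_comm.1 hab)
  have ha0 : a ≠ 0 := by rintro rfl; exact haK isAlgebraic_zero
  have hb0 : b ≠ 0 := by rintro rfl; exact hbK isAlgebraic_zero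
  have hRL : ∀ (L : IntermediateField K E), ∀ r ∈ R, r ∈ L := by
    intro L r hr
    obtain ⟨c, rfl⟩ := hR r hr
    exact L.algebraMap_mem c
  have hBL : ∀ c : E, ∀ z ∈ Subring.closure (R ∪ {c, c⁻¹} : Set E), z ∈ K⟮c⟯ := by
    intro c
    suffices Subring.closure (R ∪ {c, c⁻¹} : Set E) ≤ K⟮c⟯.toSubfield.toSubring from this
    rw [Subring.closure_le]
    rintro z (hz | rfl | rfl)
    · exact hRL _ z hz
    · exact IntermediateField.mem_adjoin_simple_self K z
    · exact (inv_mem (IntermediateField.mem_adjoin_simple_self K c) : c⁻¹ ∈ K⟮c⟯)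
  set U := Subring.closure (R ∪ {b', a, b, a'} : Set E)
  set C := Subring.closure (R ∪ {b} : Set E) with hC
  set V := Subring.closure (C ∪ {a, a⁻¹} : Set E)
  have hRU : ∀ r ∈ R, r ∈ U := fun r hr => Subring.subset_closure (Or.inl hr)
  have haU : a ∈ U := Subring.subset_closure (by simp)
  have hbU : b ∈ U := Subring.subset_closure (by simp)
  have ha'U : a' ∈ U := Subring.subset_closure (by simp)
  have hb'U : b' ∈ U := Subring.subset_closure (by simp)
  have hRC : ∀ r ∈ R, r ∈ C := fun r hr => Subring.subset_closure (Or.inl hr)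
  have hbC : b ∈ C := Subring.subset_closure (by simp)
  have hCV : C ≤ V := fun r hr => Subring.subset_closure (Or.inl hr)
  have haV : a ∈ V := Subring.subset_closure (by simp)
  have ha_invV : a⁻¹ ∈ V := Subring.subset_closure (by simp)
  have hCU : C ≤ U := by
    rw [hC, Subring.closure_le]
    rintro z (hz | rfl)
    exacts [hRU z hz, hbU]
  have hDU : Subring.closure (R ∪ {a} : Set E) ≤ U := by
    rw [Subring.closure_le]
    rintro z (hz | rfl)
    exacts [hRU z hz, haU]
  have hDV : Subring.closure (R ∪ {a} : Set E) ≤ V := by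
    rw [Subring.closure_le]
    rintro z (hz | rfl)
    exacts [hCV (hRC z hz), haV]
  have hBaV : Subring.closure (R ∪ {a, a⁻¹} : Set E) ≤ V :=
    Subring.closure_mono (Set.union_subset_union_left _ hRC)
  have hCB : C ≤ Subring.closure (R ∪ {b, b⁻¹} : Set E) := by
    refine Subring.closure_mono (Set.union_subset_union_right _ ?_)
    simp
  set e := -(b * s) with he
  have heC : e ∈ C := neg_mem (mul_mem hbC hs)
  have h1e : 1 - e = a' * a := by rw [he, haq, sub_neg_eq_add]
  have hpb : b' = p / b := by rw [← hbp, mul_div_cancel_right₀ _ hb0]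
  have hqa : a' = (1 + b * s) / a := by rw [← haq, mul_div_cancel_right₀ _ ha0]
  have hyUV : ∃ u ∈ U, ∃ v ∈ V, u + v = y := by
    obtain ⟨f, hf, hyf⟩ := exists_sum_zpow (Subring.closure (R ∪ {a, a⁻¹} : Set E)) hb0
      (y := y) <| by
        refine (Subring.closure_le.2 ?_ : _ ≤ _) h₂
        rintro z (hz | rfl | rfl | rfl | rfl)
        · exact Subring.subset_closure (Or.inl (Subring.subset_closure (Or.inl hz)))
        · exact Subring.subset_closure (Or.inl (Subring.subset_closure (by simp)))
        · exact Subring.subset_closure (Or.inl (Subring.subset_closure (by simp)))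
        · exact Subring.subset_closure (by simp)
        · exact Subring.subset_closure (by simp)
    obtain ⟨g, hg, hyg⟩ := exists_sum_zpow (Subring.closure (R ∪ {a, a⁻¹} : Set E)) hb'
      (y := y) <| by
        refine (Subring.closure_le.2 ?_ : _ ≤ _) h₁
        rintro z (hz | rfl | rfl | rfl | rfl)
        · exact Subring.subset_closure (Or.inl (Subring.subset_closure (Or.inl hz)))
        · exact Subring.subset_closure (by simp)
        · exact Subring.subset_closure (by simp)
        · exact Subring.subset_closure (Or.inl (Subring.subset_closure (by simp)))
        · exact Subring.subset_closure (Or.inl (Subring.subset_closure (by simp)))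
    have hfg := coeff_neg_eq_of_sum_zpow_eq (q := p) hb
      (hBL a p (Subring.closure_mono (Set.union_subset_union_right _ (by simp)) hp))
      (fun n => hBL a _ (hf n)) (fun n => hBL a _ (hg n)) (by rw [← hyf, hyg, hpb])
    suffices y ∈ U.toAddSubgroup ⊔ V.toAddSubgroup from AddSubgroup.mem_sup.1 this
    rw [hyf]
    refine sum_mem fun n _ => ?_
    beta_reduce
    obtain ⟨m, rfl | rfl⟩ := n.eq_nat_or_neg
    · refine (le_sup_right : V.toAddSubgroup ≤ _) ?_
      change _ ∈ V
      rw [zpow_natCast]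
      exact mul_mem (hBaV (hf m)) (pow_mem (hCV hbC) m)
    · rw [hfg m, zpow_natCast, zpow_neg, zpow_natCast]
      have hgm := hg m
      generalize g (m : ℤ) = c at hgm
      obtain ⟨k, hk⟩ := exists_pow_mul_mem_closure ha0 hgm
      obtain ⟨w, hw, σ, hσ, hwσ⟩ := exists_pow_mul_eq_one_sub heC k m
      have key : p ^ m * c * (b ^ m)⁻¹ =
          (a ^ k * c) * (a' ^ k * w ^ k * b' ^ m) +
            (a⁻¹) ^ k * (a ^ k * c) * (p ^ m * (-s) ^ m * σ) := by
        have h2 : p ^ m * (-s) ^ m = b' ^ m * e ^ m := by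
          rw [← hbp, he]; simp only [← mul_pow]; congr 1; ring
        have h3 : p ^ m * (b ^ m)⁻¹ = b' ^ m := by rw [hpb, div_pow, div_eq_mul_inv]
        have h4 : (a⁻¹) ^ k * a ^ k = 1 := by rw [← mul_pow, inv_mul_cancel₀ ha0, one_pow]
        have h5 : e ^ m * σ = 1 - (a' * a * w) ^ k := by rw [← h1e, hwσ]; ring
        calc _ = c * (p ^ m * (b ^ m)⁻¹) := by ring
          _ = c * b' ^ m * ((a' * a * w) ^ k + e ^ m * σ) := by rw [h3, h5]; ring
          _ = (a ^ k * c) * (a' ^ k * w ^ k * b' ^ m) +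
            ((a⁻¹) ^ k * a ^ k) * c * (b' ^ m * e ^ m * σ) := by rw [h4]; ring
          _ = _ := by rw [h2]; ring
      rw [key]
      refine add_mem ((le_sup_left : U.toAddSubgroup ≤ _) ?_)
        ((le_sup_right : V.toAddSubgroup ≤ _) ?_)
      · change _ ∈ U
        exact mul_mem (hDU hk) (mul_mem (mul_mem (pow_mem ha'U k) (pow_mem (hCU hw) k))
          (pow_mem hb'U m))
      · change _ ∈ V
        exact mul_mem (mul_mem (pow_mem ha_invV k) (hDV hk)) (mul_mem (mul_mem
          (pow_mem (hDV hp) m) (pow_mem (neg_mem (hCV hs)) m)) (hCV hσ))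
  obtain ⟨u, hu, v, hv, rfl⟩ := hyUV
  refine add_mem hu ?_
  have hv₃ : v ∈ Subring.closure (R ∪ {b, b⁻¹, a', a'⁻¹} : Set E) := by
    simpa using sub_mem h₃ (hle hu)
  obtain ⟨f, hf, hvf⟩ := exists_sum_zpow C ha0 hv
  obtain ⟨g, hg, hvg⟩ := exists_sum_zpow (Subring.closure (R ∪ {b, b⁻¹} : Set E)) ha'
    (y := v) <| by
      refine (Subring.closure_le.2 ?_ : _ ≤ _) hv₃
      rintro z (hz | rfl | rfl | rfl | rfl)
      · exact Subring.subset_closure (Or.inl (Subring.subset_closure (Or.inl hz)))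
      · exact Subring.subset_closure (Or.inl (Subring.subset_closure (by simp)))
      · exact Subring.subset_closure (Or.inl (Subring.subset_closure (by simp)))
      · exact Subring.subset_closure (by simp)
      · exact Subring.subset_closure (by simp)
  have hfg := coeff_neg_eq_of_sum_zpow_eq (q := 1 + b * s) ha
    (hBL b _ (hCB (add_mem (one_mem _) (mul_mem hbC hs))))
    (fun n => hBL b _ (hCB (hf n))) (fun n => hBL b _ (hg n)) (by rw [← hvf, hvg, hqa])
  rw [hvf]
  refine sum_mem fun n _ => ?_
  beta_reduce
  obtain ⟨m, rfl | rfl⟩ := n.eq_nat_or_neg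
  · rw [zpow_natCast]
    exact mul_mem (hCU (hf m)) (pow_mem haU m)
  · have hfm := hf (-m)
    rw [hfg m, zpow_natCast] at hfm
    rw [hfg m, zpow_natCast, zpow_neg, zpow_natCast]
    have hgm := hg m
    generalize g (m : ℤ) = c at hgm hfm
    obtain ⟨k, hk⟩ := exists_pow_mul_mem_closure hb0 hgm
    obtain ⟨w, hw, σ, hσ, hwσ⟩ := exists_pow_mul_eq_one_sub heC m k
    have hcC : c ∈ C := by
      have : c = w ^ m * ((1 + b * s) ^ m * c) + (-s) ^ k * σ * (b ^ k * c) := by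
        have h2 : (-s) ^ k * b ^ k = e ^ k := by
          rw [he]; simp only [← mul_pow]; congr 1; ring
        have h3 : e ^ k * σ = 1 - ((1 + b * s) * w) ^ m := by
          rw [← haq, ← h1e, hwσ]; ring
        calc c = w ^ m * ((1 + b * s) ^ m * c) + e ^ k * σ * c := by
              rw [h3, mul_pow]; ring
          _ = _ := by rw [← h2]; ring
      rw [this]
      exact add_mem (mul_mem (pow_mem hw m) hfm)
        (mul_mem (mul_mem (pow_mem (neg_mem hs) k) hσ) hk)
    have : (1 + b * s) ^ m * c * (a ^ m)⁻¹ = c * a' ^ m := by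
      rw [hqa, div_pow, div_eq_mul_inv]; ring
    rw [this]
    exact mul_mem (hCU hcC) (pow_mem ha'U m)

/-- Exchanging across a palindromic polynomial stays inside the lower bound algebra. -/
theorem mem_of_palindromic_exchange {K E : Type*} [Field K] [Field E] {f : K →+* E}
    {S : Subring E} {P : K[X]}
    (hP : Palindromic P) (hPS : ∀ i, f (P.coeff i) ∈ S)
    {u v w z t s : E} (hw : w ≠ 0) (huw : u * w = P.eval₂ f v) (hvz : v * z = 1 + w * s)
    (htw : t * w = P.eval₂ f z) (hu : u ∈ S) (hwS : w ∈ S) (hz : z ∈ S) (hs : s ∈ S) : t ∈ S := by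
  have hpow : ∀ i : ℕ, ∃ e ∈ S, (v * z) ^ i = 1 + w * e := by
    intro i
    induction i with
    | zero => exact ⟨0, zero_mem _, by simp⟩
    | succ i ih =>
      obtain ⟨e, he, h⟩ := ih
      refine ⟨e + s + w * e * s,
        add_mem (add_mem he hs) (mul_mem (mul_mem hwS he) hs), ?_⟩
      rw [pow_succ, h, hvz]
      ring
  choose e he hpow using hpow
  set d := P.natDegree
  set G := ∑ i ∈ Finset.range (d + 1), f (P.coeff i) * e i * z ^ (d - i)
  have hG : G ∈ S := sum_mem fun i _ => mul_mem (mul_mem (hPS i) (he i)) (pow_mem hz _)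
  have hrefl : ∑ i ∈ Finset.range (d + 1), f (P.coeff i) * z ^ (d - i) = P.eval₂ f z := by
    rw [eval₂_eq_sum_range, ← Finset.sum_range_reflect]
    refine Finset.sum_congr rfl fun i hi => ?_
    have hi : i ≤ d := Nat.lt_succ_iff.1 (Finset.mem_range.1 hi)
    rw [Nat.add_sub_cancel, Nat.sub_sub_self hi, ← hP i hi]
  have hmain : P.eval₂ f v * z ^ d = P.eval₂ f z + w * G := by
    rw [← hrefl, eval₂_eq_sum_range, Finset.sum_mul, Finset.mul_sum, ← Finset.sum_add_distrib]
    refine Finset.sum_congr rfl fun i hi => ?_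
    have hi : i ≤ d := Nat.lt_succ_iff.1 (Finset.mem_range.1 hi)
    calc _ = f (P.coeff i) * (v * z) ^ i * z ^ (d - i) := by
          rw [← Nat.sub_add_cancel hi, pow_add, mul_pow]
          simp only [Nat.sub_add_cancel hi]
          ring
      _ = _ := by rw [hpow]; ring
  have ht : t = u * z ^ d - G := by
    refine mul_left_cancel₀ hw ?_
    rw [← huw, ← htw] at hmain
    linear_combination -hmain
  rw [ht]
  exact sub_mem (mul_mem hu (pow_mem hz d)) hG

section ExchangePolynomial

variable {K E : Type*} [Field K] [Field E] {f : K →+* E} {P : K[X]}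

theorem Palindromic.coeff_zero (hP : Palindromic P) (hm : P.Monic) : P.coeff 0 = 1 := by
  rw [hP 0 (Nat.zero_le _), Nat.sub_zero, hm.coeff_natDegree]

theorem eval₂_mem_subring {S : Subring E} (hPS : ∀ i, f (P.coeff i) ∈ S) {z : E} (hz : z ∈ S) :
    P.eval₂ f z ∈ S := by
  rw [eval₂_eq_sum_range]
  exact sum_mem fun i _ => mul_mem (hPS i) (pow_mem hz i)

theorem eval₂_eq_one_add_mul_divX (h0 : P.coeff 0 = 1) (z : E) :
    P.eval₂ f z = 1 + z * P.divX.eval₂ f z := by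
  conv_lhs => rw [← divX_mul_X_add P]
  rw [eval₂_add, eval₂_mul, eval₂_X, eval₂_C, h0, map_one, add_comm, mul_comm]

end ExchangePolynomial

section Cluster

variable {K : Type*} [Field K] {P1 P2 : K[X]} {x : ℤ → F K}

/-- The polynomial used in the exchange relation at `x k`. -/
def exchangePoly (P1 P2 : K[X]) (k : ℤ) : K[X] := if Even k then P1 else P2

theorem exchangePoly_induction {p : K[X] → Prop} (h1 : p P1) (h2 : p P2) (k : ℤ) :
    p (exchangePoly P1 P2 k) := by
  rw [exchangePoly]
  split_ifs
  exacts [h1, h2]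

theorem exchangePoly_add_two (k : ℤ) :
    exchangePoly P1 P2 (k + 2) = exchangePoly P1 P2 k := by
  simp [exchangePoly]

theorem exchangePoly_coeff_mem (k : ℤ) (i : ℕ) : (exchangePoly P1 P2 k).coeff i ∈ uK P1 P2 :=
  exchangePoly_induction (p := fun P => P.coeff i ∈ uK P1 P2)
    (Subring.subset_closure (Or.inl ⟨i, rfl⟩)) (Subring.subset_closure (Or.inr ⟨i, rfl⟩)) k

theorem ClusterSeq.exchange (hx : ClusterSeq P1 P2 x) (k : ℤ) :
    x (k + 1) * x (k - 1) = (exchangePoly P1 P2 k).eval₂ (φ K) (x k) := by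
  rw [hx.2.2.2 k, exchangePoly]
  split_ifs <;> rfl

theorem ClusterSeq.algebraicIndependent (hx : ClusterSeq P1 P2 x) (k : ℤ) :
    AlgebraicIndependent K ![x k, x (k + 1)] := by
  have hexch : ∀ j, x (j + 1) * x (j - 1) ∈ K⟮x j⟯ := fun j => by
    rw [hx.exchange]
    exact eval₂_mem_subring (S := K⟮x j⟯.toSubfield.toSubring)
      (fun i => K⟮x j⟯.algebraMap_mem _) (IntermediateField.mem_adjoin_simple_self K (x j))
  have hne := hx.2.2.1
  induction k using Int.inductionOn' (b := 1) with
  | zero =>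
    have h : ![x 1, x (1 + 1)] = algebraMap (MvPolynomial (Fin 2) K) (F K) ∘ MvPolynomial.X := by
      funext i
      fin_cases i
      exacts [hx.1, hx.2.1]
    rw [h]
    exact (MvPolynomial.algebraicIndependent_X (Fin 2) K).map'
      (f := IsScalarTower.toAlgHom K (MvPolynomial (Fin 2) K) (F K)) (IsFractionRing.injective _ _)
  | succ k _ ih =>
    refine algebraicIndependent_pair_exchange ih ?_ (mul_ne_zero (hne _) (hne _))
    simpa using hexch (k + 1)
  | pred k _ ih =>
    rw [sub_add_cancel]
    refine algebraicIndependent_pair_comm.1 (algebraicIndependent_pair_exchange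
      (algebraicIndependent_pair_comm.1 ih) ?_ (mul_ne_zero (hne _) (hne _)))
    rw [mul_comm]
    exact hexch k

/-- The lower bound algebra, generated by four consecutive cluster variables. -/
def clU (P1 P2 : K[X]) (x : ℤ → F K) (k : ℤ) : Subring (F K) :=
  Subring.closure (φ K '' (uK P1 P2 : Set K) ∪ {x (k - 1), x k, x (k + 1), x (k + 2)})

theorem clU_le_clA (k : ℤ) : clU P1 P2 x k ≤ clA P1 P2 x := by
  refine Subring.closure_mono (Set.union_subset_union_right _ ?_)
  rintro _ (rfl | rfl | rfl | rfl) <;> exact ⟨_, rfl⟩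

variable (hm1 : P1.Monic) (hm2 : P2.Monic) (hp1 : Palindromic P1) (hp2 : Palindromic P2)
  (hx : ClusterSeq P1 P2 x)
include hx

theorem clU_le_clT (k : ℤ) : clU P1 P2 x k ≤ clT P1 P2 x k := by
  have hR : ∀ j i, φ K ((exchangePoly P1 P2 j).coeff i) ∈ clT P1 P2 x k := fun j i =>
    Subring.subset_closure (Or.inl ⟨_, exchangePoly_coeff_mem j i, rfl⟩)
  have h0 : x k ∈ clT P1 P2 x k := Subring.subset_closure (by simp)
  have h1 : x (k + 1) ∈ clT P1 P2 x k := Subring.subset_closure (by simp)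
  have h0' : (x k)⁻¹ ∈ clT P1 P2 x k := Subring.subset_closure (by simp)
  have h1' : (x (k + 1))⁻¹ ∈ clT P1 P2 x k := Subring.subset_closure (by simp)
  rw [clU, Subring.closure_le]
  rintro _ (hz | rfl | rfl | rfl | rfl)
  · exact Subring.subset_closure (Or.inl hz)
  · have h := hx.exchange k
    rw [mul_comm, ← eq_mul_inv_iff_mul_eq₀ (hx.2.2.1 _)] at h
    rw [h]
    exact mul_mem (eval₂_mem_subring (hR k) h0) h1'
  · exact h0
  · exact h1
  · have h := hx.exchange (k + 1)
    rw [add_assoc, one_add_one_eq_two, add_sub_cancel_right,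
      ← eq_mul_inv_iff_mul_eq₀ (hx.2.2.1 _)] at h
    rw [h]
    exact mul_mem (eval₂_mem_subring (hR (k + 1)) h1) h0'

include hm1 hm2 hp1 hp2

theorem clA_le_clU (m : ℤ) : clA P1 P2 x ≤ clU P1 P2 x m := by
  set S := clU P1 P2 x m
  have hR : ∀ j i, φ K ((exchangePoly P1 P2 j).coeff i) ∈ S := fun j i =>
    Subring.subset_closure (Or.inl ⟨_, exchangePoly_coeff_mem j i, rfl⟩)
  have hne := hx.2.2.1
  have hpal := exchangePoly_induction hp1 hp2
  have hs : ∀ {j}, x j ∈ S → (exchangePoly P1 P2 j).divX.eval₂ (φ K) (x j) ∈ S := fun {j} hj =>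
    eval₂_mem_subring (fun i => by rw [coeff_divX]; exact hR j _) hj
  have h1 : ∀ j, x (j - 1) * x (j + 1) = 1 + x j * (exchangePoly P1 P2 j).divX.eval₂ (φ K) (x j) :=
    fun j => by
      rw [mul_comm, hx.exchange, eval₂_eq_one_add_mul_divX]
      exact (hpal j).coeff_zero (exchangePoly_induction hm1 hm2 j)
  have hlow : ∀ j, x (j - 2) * x j = (exchangePoly P1 P2 (j + 1)).eval₂ (φ K) (x (j - 1)) :=
    fun j => by
      rw [show j + 1 = j - 1 + 2 by ring, exchangePoly_add_two, ← hx.exchange, mul_comm,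
        sub_add_cancel, sub_sub, one_add_one_eq_two]
  have hhigh : ∀ j, x (j + 2) * x j = (exchangePoly P1 P2 (j + 1)).eval₂ (φ K) (x (j + 1)) :=
    fun j => by
      rw [← hx.exchange, add_sub_cancel_right, add_assoc, one_add_one_eq_two]
  have hfwd : ∀ j, x (j - 2) ∈ S → x j ∈ S → x (j + 1) ∈ S → x (j + 2) ∈ S :=
    fun j hu hw hz => mem_of_palindromic_exchange (hpal _) (hR _) (hne j) (hlow j) (h1 j)
      (hhigh j) hu hw hz (hs hw)
  have hbwd : ∀ j, x (j + 2) ∈ S → x j ∈ S → x (j - 1) ∈ S → x (j - 2) ∈ S :=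
    fun j hu hw hz => mem_of_palindromic_exchange (hpal _) (hR _) (hne j) (hhigh j)
      ((mul_comm _ _).trans (h1 j)) (hlow j) hu hw hz (hs hw)
  have hall : ∀ j, x (j - 1) ∈ S ∧ x j ∈ S ∧ x (j + 1) ∈ S ∧ x (j + 2) ∈ S := by
    intro j
    induction j using Int.inductionOn' (b := m) with
    | zero => refine ⟨?_, ?_, ?_, ?_⟩ <;> exact Subring.subset_closure (by simp)
    | succ j _ ih =>
      obtain ⟨ha, hb, hc, hd⟩ := ih
      rw [show j - 1 = j + 1 - 2 by ring] at ha
      rw [show j + 2 = j + 1 + 1 by ring] at hd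
      exact ⟨by simpa using hb, hc, hd, hfwd _ ha hc hd⟩
    | pred j _ ih =>
      obtain ⟨ha, hb, hc, hd⟩ := ih
      have := hbwd j hd hb ha
      rw [show j - 2 = j - 1 - 1 by ring] at this
      exact ⟨this, ha, by simpa using hb, by rwa [show j - 1 + 2 = j + 1 by ring]⟩
  rw [clA, Subring.closure_le]
  rintro _ (hz | ⟨j, rfl⟩)
  exacts [Subring.subset_closure (Or.inl hz), (hall j).2.1]

/-- The Laurent phenomenon. -/
theorem clA_le_clT {k : ℤ} : clA P1 P2 x ≤ clT P1 P2 x k :=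
  (clA_le_clU hm1 hm2 hp1 hp2 hx k).trans (clU_le_clT hx k)

theorem mem_clA_of_mem_three_clT {m : ℤ} {y : F K} (h₁ : y ∈ clT P1 P2 x (m - 1))
    (h₂ : y ∈ clT P1 P2 x m) (h₃ : y ∈ clT P1 P2 x (m + 1)) : y ∈ clA P1 P2 x := by
  refine clU_le_clA m ?_
  have hle : clU P1 P2 x m ≤ clT P1 P2 x (m + 1) :=
    (clU_le_clA m).trans (clA_le_clT hm1 hm2 hp1 hp2 hx)
  rw [clT, sub_add_cancel] at h₁
  rw [clT, add_assoc, one_add_one_eq_two] at h₃ hle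
  have hR : ∀ j i (z : F K), φ K ((exchangePoly P1 P2 j).coeff i) ∈
      Subring.closure ((uK P1 P2).map (φ K) ∪ {z} : Set (F K)) := fun j i z =>
    Subring.subset_closure (Or.inl ⟨_, exchangePoly_coeff_mem j i, rfl⟩)
  refine mem_closure_of_mem_three_clusters (R := (uK P1 P2).map (φ K))
    (p := (exchangePoly P1 P2 m).eval₂ (φ K) (x m))
    (s := (exchangePoly P1 P2 (m + 1)).divX.eval₂ (φ K) (x (m + 1)))
    ?_ (hx.algebraicIndependent m) (hx.2.2.1 _) (hx.2.2.1 _)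
    (eval₂_mem_subring (fun i => hR m i _) (Subring.subset_closure (by simp))) ?_
    (eval₂_mem_subring (fun i => by rw [coeff_divX]; exact hR _ _ _)
      (Subring.subset_closure (by simp))) ?_ hle h₁ h₂ h₃
  · rintro _ ⟨r, -, rfl⟩
    exact ⟨r, rfl⟩
  · rw [mul_comm, hx.exchange]
  · rw [← eval₂_eq_one_add_mul_divX
      ((exchangePoly_induction hp1 hp2 _).coeff_zero (exchangePoly_induction hm1 hm2 _)),
      ← hx.exchange, add_sub_cancel_right, add_assoc, one_add_one_eq_two]

end Cluster

/-- **Strong Laurent Phenomenon.** `A(P1,P2) = ⋂_k T_k = T_{m-1} ∩ T_m ∩ T_{m+1}`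
for every `m`. -/
theorem strong_laurent_phenomenon {K : Type*} [Field K] [CharZero K] (P1 P2 : K[X])
    (hm1 : P1.Monic) (hm2 : P2.Monic) (hp1 : Palindromic P1) (hp2 : Palindromic P2)
    (x : ℤ → F K) (hx : ClusterSeq P1 P2 x) :
    ∀ m : ℤ, (∀ y : F K, y ∈ clA P1 P2 x ↔ ∀ k : ℤ, y ∈ clT P1 P2 x k) ∧
      (∀ y : F K, y ∈ clA P1 P2 x ↔
        (y ∈ clT P1 P2 x (m - 1) ∧ y ∈ clT P1 P2 x m ∧ y ∈ clT P1 P2 x (m + 1))) := by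
  have hA := fun k => clA_le_clT hm1 hm2 hp1 hp2 hx (k := k)
  have hmem := fun m y => mem_clA_of_mem_three_clT hm1 hm2 hp1 hp2 hx (m := m) (y := y)
  exact fun m => ⟨fun y => ⟨fun hy k => hA k hy, fun hy => hmem m y (hy _) (hy _) (hy _)⟩,
    fun y => ⟨fun hy => ⟨hA _ hy, hA _ hy, hA _ hy⟩, fun hy => hmem m y hy.1 hy.2.1 hy.2.2⟩⟩

end GCA
end
end

section
/- Fix integers d1, d2 ≥ 0 and let (S1,S2) be a bounded compatible pair on D_{a1,a2} (S1 ≤ d1 and S2 ≤ d2 pointwise). Then: (a) if 0 ≤ d2·a2 ≤ a1, then 0 ≤ |S2| ≤ d2·a2 and |S1| ≤ d1·(a1 − |S2|); (b) if 0 ≤ d1·a1 ≤ a2, then 0 ≤ |S1| ≤ d1·a1 and |S2| ≤ d2·(a2 − |S1|); (c) if 0 < a1 < d2·a2 and 0 < a2 < d1·a1, then |S1| ≤ d1·a1, |S2| ≤ d2·a2, and at least one of the following holds: (i) |S2| < a1, and moreover a1·|S1| < d1·a1·(a1−|S2|) + a2·|S2| whenever |S2| > 0; (ii) |S1| < a2,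 and moreover a2·|S2| < d2·a2·(a2−|S1|) + a1·|S1| whenever |S1| > 0. (This says (|S1|,|S2|) lies in the non-convex quadrilateral with vertices (0,0), (d1a1,0), (a2,a1), (0,d2a2), where the half-open boundary segments ((d1a1,0),(a2,a1)] and ((0,d2a2),(a2,a1)] are excluded.) -/
open scoped Classical
noncomputable section

namespace Dyck

/-- The edges of the maximal Dyck path `D_{a,b}`: `a` horizontal edges
`h_1, …, h_a` (0-indexed here) and `b` vertical edges `v_1, …, v_b`. -/
abbrev Edge (a b : ℕ) := Fin a ⊕ Fin b

/-- The height of the horizontal edge `h_{j+1}` of `D_{a,b}` is `⌊j·b/a⌋`. -/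
def ht (a b : ℕ) (j : Fin a) : ℕ := j.1 * b / a

/-- The depth of the vertical edge `v_{j+1}` of `D_{a,b}` is `⌈(j+1)·a/b⌉`. -/
def dep (a b : ℕ) (j : Fin b) : ℕ := ((j.1 + 1) * a + b - 1) / b

/-- The position (0-indexed) of an edge along the maximal Dyck path `D_{a,b}`:
a horizontal edge `h_{j+1}` is preceded by `j` horizontal edges and by `ht j`
vertical edges; a vertical edge `v_{j+1}` is preceded by `j` vertical edges and
by `dep j` horizontal edges. -/
def pos (a b : ℕ) : Edge a b → ℕ
  | Sum.inl j => j.1 + ht a b j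
  | Sum.inr j => j.1 + dep a b j

/-- Cyclic distance from `e` to `f` along the closed loop `D_{a,b}`
(the endpoints `(0,0)` and `(a,b)` are identified). -/
def dd (a b : ℕ) (e f : Edge a b) : ℕ := (pos a b f + (a + b) - pos a b e) % (a + b)

/-- The (cyclic) subpath of `D_{a,b}` from `e` to `f`, both included. -/
def subpath (a b : ℕ) (e f : Edge a b) : Finset (Edge a b) :=
  Finset.univ.filter fun g => dd a b e g ≤ dd a b e f

/-- The number of horizontal edges in a set of edges. -/
def hcount (a b : ℕ) (s : Finset (Edge a b)) : ℕ := (s.filter fun e => e.isLeft = true).card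

/-- The number of vertical edges in a set of edges. -/
def vcount (a b : ℕ) (s : Finset (Edge a b)) : ℕ := (s.filter fun e => e.isRight = true).card

/-- The sum of a horizontal grading over the horizontal edges of a set of edges. -/
def hsum (a b : ℕ) (S1 : Fin a → ℕ) (s : Finset (Edge a b)) : ℕ :=
  ∑ e ∈ s, Sum.elim S1 (fun _ => 0) e

/-- The sum of a vertical grading over the vertical edges of a set of edges. -/
def vsum (a b : ℕ) (S2 : Fin b → ℕ) (s : Finset (Edge a b)) : ℕ :=
  ∑ e ∈ s, Sum.elim (fun _ => 0) S2 e

/-- The horizontal shadow statistic `f_{S1}` of a set of edges. -/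
def fH (a b : ℕ) (S1 : Fin a → ℕ) (s : Finset (Edge a b)) : ℤ :=
  (hsum a b S1 s : ℤ) - (vcount a b s : ℤ)

/-- The vertical shadow statistic `f_{S2}` of a set of edges. -/
def fV (a b : ℕ) (S2 : Fin b → ℕ) (s : Finset (Edge a b)) : ℤ :=
  (vsum a b S2 s : ℤ) - (hcount a b s : ℤ)

/-- Horizontal grading condition (HGC) for the pair `(h, v)`: there is an edge `e`
with `he` a proper subpath of `hv` and `|(he)_2| = Σ_{h' ∈ (he)_1} S1(h')`. -/
def HGC (a b : ℕ) (S1 : Fin a → ℕ) (h : Fin a) (v : Fin b) : Prop :=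
  ∃ e : Edge a b, dd a b (.inl h) e < dd a b (.inl h) (.inr v) ∧
    vcount a b (subpath a b (.inl h) e) = hsum a b S1 (subpath a b (.inl h) e)

/-- Vertical grading condition (VGC) for the pair `(h, v)`: there is an edge `e`
with `ev` a proper subpath of `hv` and `|(ev)_1| = Σ_{v' ∈ (ev)_2} S2(v')`. -/
def VGC (a b : ℕ) (S2 : Fin b → ℕ) (h : Fin a) (v : Fin b) : Prop :=
  ∃ e : Edge a b, 0 < dd a b (.inl h) e ∧ dd a b (.inl h) e ≤ dd a b (.inl h) (.inr v) ∧
    hcount a b (subpath a b e (.inr v)) = vsum a b S2 (subpath a b e (.inr v))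

/-- A pair of gradings `(S1, S2)` on `D_{a,b}` is compatible. -/
def Compatible (a b : ℕ) (S1 : Fin a → ℕ) (S2 : Fin b → ℕ) : Prop :=
  ∀ (h : Fin a) (v : Fin b), HGC a b S1 h v ∨ VGC a b S2 h v

/-- `e` is a "balanced" endpoint for the horizontal edge `h`:
`|(he)_2| = Σ_{h' ∈ (he)_1} S1(h')`. -/
def balH (a b : ℕ) (S1 : Fin a → ℕ) (h : Fin a) (e : Edge a b) : Prop :=
  vcount a b (subpath a b (.inl h) e) = hsum a b S1 (subpath a b (.inl h) e)

/-- The local shadow `sh(h; S1)`: the vertical edges of the shortest balanced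
subpath starting at `h` (all of `D2` if there is none). -/
def shH (a b : ℕ) (S1 : Fin a → ℕ) (h : Fin a) : Finset (Fin b) :=
  Finset.univ.filter fun v =>
    ∀ e : Edge a b, balH a b S1 h e → dd a b (.inl h) (.inr v) ≤ dd a b (.inl h) e

/-- The shadow `sh(S1) = ⋃_h sh(h; S1)`. -/
def shadowH (a b : ℕ) (S1 : Fin a → ℕ) : Finset (Fin b) :=
  Finset.univ.filter fun v => ∃ h : Fin a, v ∈ shH a b S1 h

/-- The vertical edges removed from `sh(S1)` to form the remote shadow: for each
`d ∈ [1,a]`, the (up to) `S1(h_d)` vertical edges of depth `d` immediately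
following `h_d`. -/
def removedH (a b : ℕ) (S1 : Fin a → ℕ) : Finset (Fin b) :=
  Finset.univ.filter fun v => ∃ hd : Fin a, hd.1 + 1 = dep a b v ∧
    (Finset.univ.filter fun v' : Fin b => dep a b v' = dep a b v ∧ v'.1 < v.1).card < S1 hd

/-- The remote shadow `rsh(S1)`. -/
def rshH (a b : ℕ) (S1 : Fin a → ℕ) : Finset (Fin b) :=
  shadowH a b S1 \ removedH a b S1

/-- `e` is a "balanced" starting point for the vertical edge `v`:
`|(ev)_1| = Σ_{v' ∈ (ev)_2} S2(v')`. -/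
def balV (a b : ℕ) (S2 : Fin b → ℕ) (e : Edge a b) (v : Fin b) : Prop :=
  hcount a b (subpath a b e (.inr v)) = vsum a b S2 (subpath a b e (.inr v))

/-- The local shadow `sh(v; S2)`: the horizontal edges of the shortest balanced
subpath ending at `v` (all of `D1` if there is none). -/
def shV (a b : ℕ) (S2 : Fin b → ℕ) (v : Fin b) : Finset (Fin a) :=
  Finset.univ.filter fun h =>
    ∀ e : Edge a b, balV a b S2 e v → dd a b (.inl h) (.inr v) ≤ dd a b e (.inr v)

/-- The shadow `sh(S2) = ⋃_v sh(v; S2)`. -/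
def shadowV (a b : ℕ) (S2 : Fin b → ℕ) : Finset (Fin a) :=
  Finset.univ.filter fun h => ∃ v : Fin b, h ∈ shV a b S2 v

/-- The horizontal edges removed from `sh(S2)` to form the remote shadow: for each
`ℓ ∈ [1,b]`, the (up to) `S2(v_ℓ)` horizontal edges of height `ℓ−1` immediately
preceding `v_ℓ`. -/
def removedV (a b : ℕ) (S2 : Fin b → ℕ) : Finset (Fin a) :=
  Finset.univ.filter fun h => ∃ vl : Fin b, vl.1 = ht a b h ∧
    (Finset.univ.filter fun h' : Fin a => ht a b h' = ht a b h ∧ h.1 < h'.1).card < S2 vl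

/-- The remote shadow `rsh(S2)`. -/
def rshV (a b : ℕ) (S2 : Fin b → ℕ) : Finset (Fin a) :=
  shadowV a b S2 \ removedV a b S2

/-- The support of a grading. -/
def suppH (a : ℕ) (S1 : Fin a → ℕ) : Finset (Fin a) := Finset.univ.filter fun h => S1 h ≠ 0
def suppV (b : ℕ) (S2 : Fin b → ℕ) : Finset (Fin b) := Finset.univ.filter fun v => S2 v ≠ 0

/-- Prefix counts of horizontal and vertical edges (`hc`, `vc`) and prefix sums of the two
gradings (`hs`, `vs`) along the universal cover `ℤ` of the closed loop `D_{a,b}` carrying a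
bounded compatible pair of magnitudes `σ1`, `σ2`. -/
structure IsWalk (a b d1 d2 σ1 σ2 : ℤ) (hc vc hs vs : ℤ → ℤ) : Prop where
  step : ∀ i, (hc (i + 1) = hc i + 1 ∧ vc (i + 1) = vc i ∧ hs i ≤ hs (i + 1) ∧
      hs (i + 1) ≤ hs i + d1 ∧ vs (i + 1) = vs i) ∨
    (vc (i + 1) = vc i + 1 ∧ hc (i + 1) = hc i ∧ vs i ≤ vs (i + 1) ∧
      vs (i + 1) ≤ vs i + d2 ∧ hs (i + 1) = hs i)
  defect_nonneg : ∀ i, 0 ≤ b * hc i - a * vc i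
  defect_lt : ∀ i, b * hc i - a * vc i < a + b
  hc_period : ∀ i, hc (i + (a + b)) = hc i + a
  vc_period : ∀ i, vc (i + (a + b)) = vc i + b
  hs_period : ∀ i, hs (i + (a + b)) = hs i + σ1
  vs_period : ∀ i, vs (i + (a + b)) = vs i + σ2
  compat : ∀ i j, i < j → j < i + (a + b) → hc (i + 1) = hc i + 1 → vc (j + 1) = vc j + 1 →
    (∃ k, i < k ∧ k ≤ j ∧ hs k - vc k = hs i - vc i) ∨
    (∃ k, i < k ∧ k ≤ j ∧ vs k - hc k = vs (j + 1) - hc (j + 1))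

namespace IsWalk

variable {a b d1 d2 σ1 σ2 : ℤ} {hc vc hs vs : ℤ → ℤ}

/-- Reversing the path exchanges the roles of horizontal and vertical edges. -/
theorem reverse (w : IsWalk a b d1 d2 σ1 σ2 hc vc hs vs) :
    IsWalk b a d2 d1 σ2 σ1 (fun i => -vc (-i)) (fun i => -hc (-i))
      (fun i => -vs (-i)) (fun i => -hs (-i)) where
  step i := by
    have h := w.step (-(i + 1))
    rw [show -(i + 1) + 1 = -i by ring] at h
    omega
  defect_nonneg i := by have := w.defect_nonneg (-i); linarith
  defect_lt i := by have := w.defect_lt (-i); linarith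
  hc_period i := by
    have h := w.vc_period (-(i + (b + a)))
    rw [show -(i + (b + a)) + (a + b) = -i by ring] at h
    omega
  vc_period i := by
    have h := w.hc_period (-(i + (b + a)))
    rw [show -(i + (b + a)) + (a + b) = -i by ring] at h
    omega
  hs_period i := by
    have h := w.vs_period (-(i + (b + a)))
    rw [show -(i + (b + a)) + (a + b) = -i by ring] at h
    omega
  vs_period i := by
    have h := w.hs_period (-(i + (b + a)))
    rw [show -(i + (b + a)) + (a + b) = -i by ring] at h
    omega
  compat i j hij hji hi hj := by
    have h := w.compat (-(j + 1)) (-(i + 1)) (by omega) (by omega)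
    rw [show -(i + 1) + 1 = -i by ring, show -(j + 1) + 1 = -j by ring] at h
    rcases h (by omega) (by omega) with ⟨k, h1, h2, h3⟩ | ⟨k, h1, h2, h3⟩
    · refine Or.inr ⟨-k, by omega, by omega, ?_⟩
      rw [neg_neg]
      omega
    · refine Or.inl ⟨-k, by omega, by omega, ?_⟩
      rw [neg_neg]
      omega

/-- If every proper suffix of a subpath ending in the vertical edge `j` is unbalanced for the
vertical grading, then the horizontal grading of the subpath is at most the number of its
vertical edges other than `j`. -/
theorem hs_sub_vc_le (w : IsWalk a b d1 d2 σ1 σ2 hc vc hs vs) {x j : ℤ} (hxj : x ≤ j)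
    (hN : j < x + (a + b)) (hj : vc (j + 1) = vc j + 1)
    (hlt : ∀ k, x < k → k ≤ j → vs k - hc k < vs (j + 1) - hc (j + 1)) :
    hs j - vc j ≤ hs x - vc x := by
  induction hn : (j - x).toNat using Nat.strong_induction_on generalizing x with
  | _ n ih =>
    rcases hxj.eq_or_lt with rfl | hxj'
    · exact le_rfl
    have ih' : ∀ y, x < y → y ≤ j → hs j - vc j ≤ hs y - vc y := fun y h1 h2 =>
      ih _ (by omega) h2 (by omega) (fun k hk hk' => hlt k (by omega) hk') rfl
    rcases w.step x with h | h
    · rcases w.compat x j hxj' hN h.1 hj with ⟨k, h1, h2, h3⟩ | ⟨k, h1, h2, h3⟩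
      · exact h3 ▸ ih' k h1 h2
      · exact absurd h3 (hlt k h1 h2).ne
    · have := ih' (x + 1) (by omega) (by omega)
      omega

/-- The magnitude estimate along an interval starting at a maximum, assuming it on minimal
balanced subpaths. -/
theorem hs_le_of_arcs (w : IsWalk a b d1 d2 σ1 σ2 hc vc hs vs) (ha : 0 ≤ a) {c δ x z : ℤ}
    (arc : ∀ e y, x ≤ e → e < y → y < z → vs y < vs (y + 1) → vc (y + 1) = vc y + 1 →
      vs e - hc e = vs (y + 1) - hc (y + 1) →
      (∀ k, e < k → k ≤ y → vs k - hc k < vs (y + 1) - hc (y + 1)) →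
      a * (hs (y + 1) - hs e) + δ ≤ c * (hc (y + 1) - hc e))
    (hδ : 0 ≤ δ) {y : ℤ} (hxy : x ≤ y) (hyz : y ≤ z)
    (hmax : ∀ k, x ≤ k → k ≤ y → vs k - hc k ≤ vs x - hc x) :
    (vs y = vs x ∧ a * (hs y - hs x) ≤ d1 * a * ((vs x - hc x) - (vs y - hc y)) +
        c * (vs y - vs x)) ∨
      a * (hs y - hs x) + δ ≤ d1 * a * ((vs x - hc x) - (vs y - hc y)) + c * (vs y - vs x) := by
  induction hn : (y - x).toNat using Nat.strong_induction_on generalizing y with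
  | _ n ih =>
    rcases hxy.eq_or_lt with rfl | hxy'
    · left; simp
    have ih' : ∀ u, x ≤ u → u < y → _ := fun u h1 h2 =>
      ih _ (by omega) h1 (by omega) (fun k hk hk' => hmax k hk (by omega)) rfl
    obtain ⟨y, rfl⟩ : ∃ u, y = u + 1 := ⟨y - 1, by ring⟩
    rcases w.step y with h | h
    · have hbound : a * hs (y + 1) ≤ a * (hs y + d1) :=
        mul_le_mul_of_nonneg_left h.2.2.2.1 ha
      rcases ih' y (by omega) (by omega) with ⟨h1, h2⟩ | h2
      · left
        refine ⟨by omega, ?_⟩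
        rw [h.1, h.2.2.2.2]
        linarith
      · right
        rw [h.1, h.2.2.2.2]
        linarith
    · rcases h.2.2.1.eq_or_lt with heq | hlt
      · rcases ih' y (by omega) (by omega) with ⟨h1, h2⟩ | h2
        · left
          refine ⟨by omega, ?_⟩
          rw [h.2.1, h.2.2.2.2, ← heq]
          exact h2
        · right
          rw [h.2.1, h.2.2.2.2, ← heq]
          exact h2
      · obtain ⟨e, ⟨he1, he2, he3⟩, he4⟩ := Int.exists_greatest_of_bdd
          (P := fun e => x ≤ e ∧ e ≤ y ∧ vs (y + 1) - hc (y + 1) ≤ vs e - hc e)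
          ⟨y, fun _ hz => hz.2.1⟩ ⟨x, le_rfl, by omega, hmax _ (by omega) le_rfl⟩
        have hey : e ≠ y := by rintro rfl; omega
        have hmin : ∀ k, e < k → k ≤ y → vs k - hc k < vs (y + 1) - hc (y + 1) := by
          intro k hk hk'
          by_contra hcon
          have := he4 k ⟨by omega, hk', by omega⟩
          omega
        have heq : vs e - hc e = vs (y + 1) - hc (y + 1) := by
          have h1 := hmin (e + 1) (by omega) (by omega)
          rcases w.step e with h2 | h2 <;> omega
        have key := arc e y he1 (by omega) (by omega) hlt h.1 heq hmin
        have hmul : c * (hc (y + 1) - hc e) = c * (vs (y + 1) - vs e) := by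
          congr 1; omega
        right
        rw [← heq]
        rcases ih' e he1 (by omega) with ⟨h1, h2⟩ | h2 <;> linarith

theorem exists_max (w : IsWalk a b d1 d2 σ1 σ2 hc vc hs vs) (hN : 0 < a + b) (hσ : σ2 ≤ a) :
    ∃ x, ∀ k, x ≤ k → k ≤ x + (a + b) → vs k - hc k ≤ vs x - hc x := by
  obtain ⟨x, hx, hmax⟩ := Finset.exists_max_image (Finset.Ico 0 (a + b))
    (fun k => vs k - hc k) ⟨0, by simpa using hN⟩
  rw [Finset.mem_Ico] at hx
  refine ⟨x, fun k hk hk' => ?_⟩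
  by_cases hkN : k < a + b
  · exact hmax k (Finset.mem_Ico.2 ⟨by omega, hkN⟩)
  · have h1 := hmax (k - (a + b)) (Finset.mem_Ico.2 ⟨by omega, by omega⟩)
    have h2 := w.vs_period (k - (a + b))
    have h3 := w.hc_period (k - (a + b))
    rw [sub_add_cancel] at h2 h3
    omega

theorem arc_estimate (w : IsWalk a b d1 d2 σ1 σ2 hc vc hs vs) (ha : 0 ≤ a) {e y : ℤ}
    (hey : e < y) (hyN : y < e + (a + b)) (hy : vc (y + 1) = vc y + 1)
    (heq : vs e - hc e = vs (y + 1) - hc (y + 1))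
    (hmin : ∀ k, e < k → k ≤ y → vs k - hc k < vs (y + 1) - hc (y + 1)) :
    a * (hs (y + 1) - hs e) + 1 ≤ b * (hc (y + 1) - hc e) := by
  have h1 := w.hs_sub_vc_le hey.le hyN hy hmin
  have hs_y : hs (y + 1) = hs y := by rcases w.step y with h | h <;> omega
  have he : hc (e + 1) = hc e + 1 ∧ vc (e + 1) = vc e := by
    have := hmin (e + 1) (by omega) (by omega)
    rcases w.step e with h | h <;> omega
  have h2 := w.defect_lt (e + 1)
  have h3 := w.defect_nonneg (y + 1)
  rw [he.1, he.2] at h2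
  have h4 : a * (hs (y + 1) - hs e) ≤ a * (vc (y + 1) - 1 - vc e) :=
    mul_le_mul_of_nonneg_left (by omega) ha
  linarith

theorem magnitude_lt (w : IsWalk a b d1 d2 σ1 σ2 hc vc hs vs) (ha : 0 < a) (hb : 0 < b)
    (hσ : σ2 ≤ a) (hpos : 0 < σ2) : a * σ1 < d1 * a * (a - σ2) + b * σ2 := by
  obtain ⟨x, hx⟩ := w.exists_max (by omega) hσ
  have key := w.hs_le_of_arcs (z := x + (a + b)) (δ := 1) ha.le
    (fun e y h1 h2 h3 _ h5 h6 h7 => w.arc_estimate ha.le h2 (by omega) h5 h6 h7)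
    (by norm_num) (by omega) le_rfl hx
  rw [w.vs_period, w.hs_period, w.hc_period] at key
  rcases key with ⟨h, -⟩ | h
  · omega
  · linarith

theorem magnitude_le (w : IsWalk a b d1 d2 σ1 σ2 hc vc hs vs) (ha : 0 < a) (hb : 0 < b)
    (hσ : σ2 ≤ a) (hd : d2 * b ≤ a) : σ1 ≤ d1 * (a - σ2) := by
  obtain ⟨x, hx⟩ := w.exists_max (by omega) hσ
  have key := w.hs_le_of_arcs (z := x + (a + b)) (δ := 0) (c := 0) ha.le (x := x)
    (fun e y h1 h2 h3 _ h5 h6 h7 => by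
      have hvc : ∀ k, k ≤ y → e ≤ k → vc k = vc y ∧ vs k = vs y := by
        intro k hk
        induction k, hk using Int.leInductionDown with
        | base => intro _; exact ⟨rfl, rfl⟩
        | pred k hk ih =>
          intro hek
          obtain ⟨i1, i2⟩ := ih (by omega)
          have hs1 := w.step (k - 1)
          rw [sub_add_cancel] at hs1
          rcases hs1 with h | h
          · exact ⟨by omega, by omega⟩
          · exfalso
            have hk7 := h7 k (by omega) hk
            have hsy : vs (y + 1) ≤ vs y + d2 := by
              rcases w.step y with h' | h' <;> omega
            have h8 := w.defect_lt (k - 1)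
            have h9' := w.defect_nonneg (y + 1)
            rw [h5] at h9'
            have : vc y = vc (k - 1) + 1 := by omega
            rw [this] at h9'
            have hle : b * (hc (y + 1) - hc (k - 1)) ≤ b * (d2 - 1) :=
              mul_le_mul_of_nonneg_left (by omega) hb.le
            linarith
      have h8 := w.hs_sub_vc_le h2.le (by omega) h5 h7
      have h9 := hvc e h2.le le_rfl
      have hs_y : hs (y + 1) = hs y := by rcases w.step y with h | h <;> omega
      have : a * (hs (y + 1) - hs e) ≤ a * 0 := mul_le_mul_of_nonneg_left (by omega) ha.le
      linarith)
    le_rfl (by omega) le_rfl hx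
  rw [w.vs_period, w.hs_period, w.hc_period] at key
  have : a * σ1 ≤ a * (d1 * (a - σ2)) := by
    rcases key with ⟨-, h⟩ | h <;> linarith
  exact le_of_mul_le_mul_left this ha

theorem magnitude_lt_of_lt (w : IsWalk a b d1 d2 σ1 σ2 hc vc hs vs) (ha : 0 < a) (hb : 0 < b)
    (hσ : a < σ2) : σ1 < b := by
  obtain ⟨y, hy, hmax⟩ := Finset.exists_max_image (Finset.Ioc 0 (a + b))
    (fun k => (vs k - hc k) * (a + b) - k) ⟨a + b, by simp; omega⟩
  rw [Finset.mem_Ioc] at hy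
  have hlt : ∀ k, y - (a + b) < k → k < y → vs k - hc k < vs y - hc y := by
    intro k hk hk'
    by_cases hk0 : 0 < k
    · have h := hmax k (Finset.mem_Ioc.2 ⟨hk0, by omega⟩)
      exact lt_of_mul_lt_mul_right (a := a + b) (by omega) (by omega)
    · have h := hmax (k + (a + b)) (Finset.mem_Ioc.2 ⟨by omega, by omega⟩)
      have h2 := w.vs_period k
      have h3 := w.hc_period k
      have h4 : (vs (k + (a + b)) - hc (k + (a + b))) * (a + b) < (vs y - hc y + 1) * (a + b) := by
        rw [add_mul]
        omega
      have := lt_of_mul_lt_mul_right h4 (by omega)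
      omega
  obtain ⟨j, rfl⟩ : ∃ j, y = j + 1 := ⟨y - 1, by ring⟩
  have hj : vc (j + 1) = vc j + 1 ∧ hs (j + 1) = hs j := by
    have := hlt j (by omega) (by omega)
    rcases w.step j with h | h <;> omega
  have h := w.hs_sub_vc_le (x := j + 1 - (a + b)) (by omega) (by omega) hj.1
    (fun k hk hk' => hlt k hk (by omega))
  have h1 := w.hs_period (j + 1 - (a + b))
  have h2 := w.vc_period (j + 1 - (a + b))
  rw [sub_add_cancel] at h1 h2
  omega

end IsWalk

section Concrete

variable {a b : ℕ}

theorem pos_inl_mul (ha : 0 < a) (j : Fin a) :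
    ∃ r, r < a ∧ pos a b (.inl j) * b = ht a b j * (a + b) + r := by
  refine ⟨j.1 * b % a, Nat.mod_lt _ ha, ?_⟩
  have h := Nat.div_add_mod (j.1 * b) a
  simp only [pos, ht]
  nlinarith

theorem pos_inr_mul (hb : 0 < b) (j : Fin b) :
    ∃ r, a ≤ r ∧ r < a + b ∧ pos a b (.inr j) * b = j.1 * (a + b) + r := by
  have h1 : dep a b j * b ≤ (j.1 + 1) * a + b - 1 := Nat.div_mul_le_self _ _
  have h2 : (j.1 + 1) * a + b - 1 < (dep a b j + 1) * b :=
    (Nat.div_lt_iff_lt_mul hb).1 (Nat.lt_succ_self _)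
  have h3 : (j.1 + 1) * a = j.1 * a + a := by ring
  have h4 : (dep a b j + 1) * b = dep a b j * b + b := by ring
  refine ⟨dep a b j * b - j.1 * a, by omega, by omega, ?_⟩
  have h5 : pos a b (.inr j) * b = j.1 * b + dep a b j * b := by simp only [pos]; ring
  have h6 : j.1 * (a + b) = j.1 * a + j.1 * b := by ring
  omega

theorem pos_lt (ha : 0 < a) (hb : 0 < b) (e : Edge a b) : pos a b e < a + b := by
  rcases e with j | j
  · have : ht a b j < b := by
      rw [ht, Nat.div_lt_iff_lt_mul ha, mul_comm b]
      exact Nat.mul_lt_mul_of_pos_right j.2 hb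
    have := j.2
    simp only [pos]
    omega
  · obtain ⟨r, -, hr, h⟩ := pos_inr_mul (a := a) hb j
    refine lt_of_mul_lt_mul_right (a := b) ?_ (Nat.zero_le _)
    have : (j.1 + 1) * (a + b) ≤ b * (a + b) := Nat.mul_le_mul_right _ j.2
    rw [h]
    nlinarith

theorem isLeft_iff_pos_mul_mod (ha : 0 < a) (hb : 0 < b) (e : Edge a b) :
    e.isLeft = true ↔ pos a b e * b % (a + b) < a := by
  rcases e with j | j
  · obtain ⟨r, hr, h⟩ := pos_inl_mul (b := b) ha j
    rw [h, Nat.mul_add_mod_of_lt (by omega)]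
    simpa using hr
  · obtain ⟨r, hr, hr', h⟩ := pos_inr_mul (a := a) hb j
    rw [h, Nat.mul_add_mod_of_lt (by omega)]
    simpa using hr

theorem quotient_unique {n x y r s : ℕ} (hr : r < n) (hs : s < n)
    (h : x * n + r = y * n + s) : x = y := by
  rcases lt_trichotomy x y with hxy | rfl | hxy
  · have := Nat.mul_le_mul_right n (Nat.succ_le_of_lt hxy)
    rw [Nat.succ_mul] at this
    omega
  · rfl
  · have := Nat.mul_le_mul_right n (Nat.succ_le_of_lt hxy)
    rw [Nat.succ_mul] at this
    omega

theorem pos_injective (ha : 0 < a) (hb : 0 < b) : Function.Injective (pos a b) := by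
  intro e f hef
  have hl := isLeft_iff_pos_mul_mod ha hb e
  rw [hef, ← isLeft_iff_pos_mul_mod ha hb f] at hl
  rcases e with i | i <;> rcases f with j | j
  · obtain ⟨r, hr, h⟩ := pos_inl_mul (b := b) ha i
    obtain ⟨s, hs, h'⟩ := pos_inl_mul (b := b) ha j
    rw [hef, h'] at h
    have hht : ht a b j = ht a b i := quotient_unique (by omega) (by omega) h
    simp only [pos] at hef
    congr 1
    ext
    omega
  · simp at hl
  · simp at hl
  · obtain ⟨r, -, hr, h⟩ := pos_inr_mul (a := a) hb i
    obtain ⟨s, -, hs, h'⟩ := pos_inr_mul (a := a) hb j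
    rw [hef, h'] at h
    congr 1
    ext
    exact (quotient_unique hs hr h).symm

theorem exists_edgeAt (ha : 0 < a) (hb : 0 < b) :
    ∃ E : ℤ → Edge a b, ∀ n, (pos a b (E n) : ℤ) = n % (a + b) := by
  let f : Edge a b → Fin (a + b) := fun e => ⟨pos a b e, pos_lt ha hb e⟩
  have hf : Function.Bijective f := by
    rw [Fintype.bijective_iff_injective_and_card]
    exact ⟨fun e e' h => pos_injective ha hb (Fin.mk.inj h), by simp⟩
  have hN : ∀ n : ℤ, 0 ≤ n % (a + b) ∧ n % (a + b) < a + b := fun n =>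
    ⟨Int.emod_nonneg _ (by omega), Int.emod_lt_of_pos _ (by omega)⟩
  choose E hE using fun n : ℤ => hf.2 ⟨(n % (a + b)).toNat, by have := hN n; omega⟩
  refine ⟨E, fun n => ?_⟩
  have h := Fin.mk.inj (hE n)
  have := hN n
  omega

theorem exists_primitive (f : ℤ → ℤ) : ∃ F : ℤ → ℤ, ∀ n, F (n + 1) = F n + f n := by
  refine ⟨fun n => ∑ i ∈ Finset.range n.toNat, f i -
    ∑ i ∈ Finset.range (-n).toNat, f (-1 - i), fun n => ?_⟩
  rcases n with n | n
  · have h1 : ((n : ℤ) + 1).toNat = n + 1 := by omega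
    have h2 : (-((n : ℤ) + 1)).toNat = 0 := by omega
    have h3 : (-(n : ℤ)).toNat = 0 := by omega
    simp only [Int.ofNat_eq_natCast, h1, h2, h3, Int.toNat_natCast, Finset.sum_range_succ,
      Finset.sum_range_zero, sub_zero]
  · have h0 : Int.negSucc n = -1 - (n : ℤ) := by omega
    have h1 : (-1 - (n : ℤ)).toNat = 0 := by omega
    have h2 : (-1 - (n : ℤ) + 1).toNat = 0 := by omega
    have h3 : (-(-1 - (n : ℤ))).toNat = n + 1 := by omega
    have h4 : (-(-1 - (n : ℤ) + 1)).toNat = n := by omega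
    simp only [h0, h1, h2, h3, h4, Finset.sum_range_succ, Finset.sum_range_zero]
    ring

theorem primitive_add {f F : ℤ → ℤ} (hF : ∀ n, F (n + 1) = F n + f n) (i : ℤ) (m : ℕ) :
    F (i + m) = F i + ∑ k ∈ Finset.range m, f (i + k) := by
  induction m with
  | zero => simp
  | succ m ih =>
    rw [Finset.sum_range_succ, ← add_assoc, ← ih, ← hF]
    push_cast
    ring_nf

theorem dd_lt (ha : 0 < a) (e f : Edge a b) : dd a b e f < a + b :=
  Nat.mod_lt _ (by omega)

theorem dd_eq (ha : 0 < a) (hb : 0 < b) (e f : Edge a b) :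
    (dd a b e f : ℤ) = ((pos a b f : ℤ) - pos a b e) % (a + b) := by
  have := pos_lt ha hb e
  rw [dd, Int.natCast_mod, Nat.cast_sub (by omega)]
  push_cast
  rw [show (pos a b f : ℤ) + (a + b) - pos a b e = pos a b f - pos a b e + (a + b) by ring,
    Int.add_emod_right]

theorem dd_edgeAt {E : ℤ → Edge a b}
    (hE : ∀ n, (pos a b (E n) : ℤ) = n % (a + b)) (ha : 0 < a) (hb : 0 < b)
    {i j : ℤ} (hij : i ≤ j) (hj : j < i + (a + b)) :
    (dd a b (E i) (E j) : ℤ) = j - i := by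
  rw [dd_eq ha hb, hE, hE, ← Int.sub_emod, Int.emod_eq_of_lt (by omega) (by omega)]

theorem edgeAt_add_dd {E : ℤ → Edge a b}
    (hE : ∀ n, (pos a b (E n) : ℤ) = n % (a + b)) (ha : 0 < a) (hb : 0 < b)
    (i : ℤ) (f : Edge a b) :
    E (i + dd a b (E i) f) = f := by
  apply pos_injective ha hb
  zify
  rw [hE, dd_eq ha hb, hE]
  have := pos_lt ha hb f
  have h := (Int.ModEq.refl i).add ((Int.ModEq.refl (pos a b f : ℤ)).sub (Int.mod_modEq i (a + b)))
  rw [Int.add_emod_emod, h, add_sub_cancel, Int.emod_eq_of_lt (by omega) (by omega)]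

/-- A sum over a subpath as a difference of values of a primitive. -/
theorem sum_subpath {E : ℤ → Edge a b}
    (hE : ∀ n, (pos a b (E n) : ℤ) = n % (a + b)) (ha : 0 < a) (hb : 0 < b)
    {φ : Edge a b → ℤ} {F : ℤ → ℤ}
    (hF : ∀ n, F (n + 1) = F n + φ (E n)) {i k : ℤ} (hik : i ≤ k) (hk : k < i + (a + b)) :
    ∑ e ∈ subpath a b (E i) (E k), φ e = F (k + 1) - F i := by
  obtain ⟨m, rfl⟩ : ∃ m : ℕ, k = i + m := ⟨(k - i).toNat, by omega⟩
  have hdd := dd_edgeAt hE ha hb hik hk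
  have h := primitive_add hF i (m + 1)
  push_cast at h
  rw [add_assoc, h, add_sub_cancel_left]
  symm
  refine Finset.sum_bij' (fun n _ => E (i + n)) (fun e _ => dd a b (E i) e) ?_ ?_ ?_ ?_ ?_
  · intro n hn
    rw [Finset.mem_range] at hn
    have := dd_edgeAt hE ha hb (show i ≤ i + n by omega) (by omega)
    simp only [subpath, Finset.mem_filter, Finset.mem_univ, true_and]
    omega
  · intro e he
    simp only [subpath, Finset.mem_filter, Finset.mem_univ, true_and] at he
    rw [Finset.mem_range]
    omega
  · intro n hn
    rw [Finset.mem_range] at hn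
    have := dd_edgeAt hE ha hb (show i ≤ i + n by omega) (by omega)
    omega
  · intro e _
    exact edgeAt_add_dd hE ha hb i e
  · intro n _
    rfl

theorem primitive_period {E : ℤ → Edge a b}
    (hE : ∀ n, (pos a b (E n) : ℤ) = n % (a + b)) (ha : 0 < a) (hb : 0 < b)
    {φ : Edge a b → ℤ} {F : ℤ → ℤ}
    (hF : ∀ n, F (n + 1) = F n + φ (E n)) (i : ℤ) :
    F (i + (a + b)) = F i + ∑ e, φ e := by
  have h := sum_subpath hE ha hb hF (i := i) (k := i + (a + b) - 1) (by omega) (by omega)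
  have hdd := dd_edgeAt hE ha hb (i := i) (j := i + (a + b) - 1) (by omega) (by omega)
  have huniv : subpath a b (E i) (E (i + (a + b) - 1)) = Finset.univ := by
    ext e
    have := dd_lt ha (E i) e
    simp only [subpath, Finset.mem_filter, Finset.mem_univ, true_and, iff_true]
    omega
  rw [huniv, sub_add_cancel] at h
  omega

theorem vcount_eq_sum (s : Finset (Edge a b)) :
    (vcount a b s : ℤ) = ∑ e ∈ s, Sum.elim (fun _ => 0) (fun _ => 1) e := by
  rw [vcount, Finset.card_filter]
  push_cast
  exact Finset.sum_congr rfl fun e _ => by rcases e with e | e <;> simp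

theorem hcount_eq_sum (s : Finset (Edge a b)) :
    (hcount a b s : ℤ) = ∑ e ∈ s, Sum.elim (fun _ => 1) (fun _ => 0) e := by
  rw [hcount, Finset.card_filter]
  push_cast
  exact Finset.sum_congr rfl fun e _ => by rcases e with e | e <;> simp

theorem hsum_eq_sum (S1 : Fin a → ℕ) (s : Finset (Edge a b)) :
    (hsum a b S1 s : ℤ) = ∑ e ∈ s, Sum.elim (fun h => (S1 h : ℤ)) (fun _ => 0) e := by
  rw [hsum]
  push_cast
  exact Finset.sum_congr rfl fun e _ => by rcases e with e | e <;> simp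

theorem vsum_eq_sum (S2 : Fin b → ℕ) (s : Finset (Edge a b)) :
    (vsum a b S2 s : ℤ) = ∑ e ∈ s, Sum.elim (fun _ => 0) (fun v => (S2 v : ℤ)) e := by
  rw [vsum]
  push_cast
  exact Finset.sum_congr rfl fun e _ => by rcases e with e | e <;> simp

theorem exists_isWalk {d1 d2 : ℕ} {S1 : Fin a → ℕ} {S2 : Fin b → ℕ} (ha : 0 < a) (hb : 0 < b)
    (hcomp : Compatible a b S1 S2) (hb1 : ∀ h, S1 h ≤ d1) (hb2 : ∀ v, S2 v ≤ d2) :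
    ∃ hc vc hs vs, IsWalk a b d1 d2 (∑ h, S1 h : ℕ) (∑ v, S2 v : ℕ) hc vc hs vs := by
  obtain ⟨E, hE⟩ := exists_edgeAt ha hb
  obtain ⟨hs, hhs⟩ := exists_primitive
    fun n => Sum.elim (fun h => (S1 h : ℤ)) (fun _ => 0) (E n)
  obtain ⟨vs, hvs⟩ := exists_primitive
    fun n => Sum.elim (fun _ => 0) (fun v => (S2 v : ℤ)) (E n)
  let vc : ℤ → ℤ := fun n => n * b / (a + b)
  let hc : ℤ → ℤ := fun n => n - vc n
  have hN : (0 : ℤ) < a + b := by omega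
  have hdiv : ∀ n, (a + b) * vc n + n * b % (a + b) = n * b := fun n =>
    Int.mul_ediv_add_emod _ _
  have hnn : ∀ n : ℤ, 0 ≤ n * b % (a + b) := fun n => Int.emod_nonneg _ hN.ne'
  have hlt : ∀ n : ℤ, n * b % (a + b) < a + b := fun n => Int.emod_lt_of_pos _ hN
  have hdefect : ∀ n, b * hc n - a * vc n = n * b % (a + b) := by
    intro n
    have := hdiv n
    simp only [hc]
    linarith
  have hleft : ∀ n, (E n).isLeft = true ↔ n * b % (a + b) < a := by
    intro n
    rw [isLeft_iff_pos_mul_mod ha hb]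
    zify
    rw [hE, (Int.mod_modEq n (a + b)).mul_right b]
  have hvc : ∀ n, vc (n + 1) = vc n + Sum.elim (fun _ => 0) (fun _ => 1) (E n) := by
    intro n
    have h := hleft n
    have h1 := hdiv n
    have h2 := hnn n
    have h3 := hlt n
    simp only [vc]
    rcases hEn : E n with j | j <;> rw [hEn] at h <;> simp at h ⊢
    · rw [Int.ediv_eq_iff_of_pos hN]
      constructor <;> simp only [vc] at h1 <;> nlinarith
    · rw [Int.ediv_eq_iff_of_pos hN]
      constructor <;> simp only [vc] at h1 <;> nlinarith
  have hhc : ∀ n, hc (n + 1) = hc n + Sum.elim (fun _ => 1) (fun _ => 0) (E n) := by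
    intro n
    have h := hvc n
    simp only [hc]
    rcases hEn : E n with j | j <;> simp [hEn] at h ⊢ <;> omega
  refine ⟨hc, vc, hs, vs, ?_, ?_, ?_, ?_, ?_, ?_, ?_, ?_⟩
  · intro i
    have h1 := hhc i
    have h2 := hvc i
    have h3 := hhs i
    have h4 := hvs i
    rcases hEi : E i with j | j <;> simp [hEi] at h1 h2 h3 h4
    · have := hb1 j
      omega
    · have := hb2 j
      omega
  · intro i
    rw [hdefect]
    exact hnn i
  · intro i
    rw [hdefect]
    exact hlt i
  · intro i
    rw [primitive_period hE ha hb hhc i]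
    simp
  · intro i
    rw [primitive_period hE ha hb hvc i]
    simp
  · intro i
    rw [primitive_period hE ha hb hhs i]
    simp
  · intro i
    rw [primitive_period hE ha hb hvs i]
    simp
  · intro i j hij hji hi hj
    have hhi := hhc i
    have hvj := hvc j
    have hdd := dd_edgeAt hE ha hb hij.le hji
    obtain ⟨h, hEi⟩ : ∃ h, E i = .inl h := by
      rcases hEi : E i with h | h
      · exact ⟨h, rfl⟩
      · simp [hEi] at hhi
        omega
    obtain ⟨v, hEj⟩ : ∃ v, E j = .inr v := by
      rcases hEj : E j with h | h
      · simp [hEj] at hvj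
        omega
      · exact ⟨h, rfl⟩
    rcases hcomp h v with ⟨e, he, heq⟩ | ⟨e, he0, he, heq⟩
    · rw [← hEi] at he heq
      rw [← hEj] at he
      have hEk := edgeAt_add_dd hE ha hb i e
      generalize dd a b (E i) e = m at he hEk
      subst hEk
      left
      refine ⟨i + m + 1, by omega, by omega, ?_⟩
      zify at heq
      rw [vcount_eq_sum, hsum_eq_sum, sum_subpath hE ha hb hvc (by omega) (by omega),
        sum_subpath hE ha hb hhs (by omega) (by omega)] at heq
      omega
    · rw [← hEi] at he he0
      rw [← hEj] at he heq
      have hEk := edgeAt_add_dd hE ha hb i e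
      generalize dd a b (E i) e = m at he he0 hEk
      subst hEk
      right
      refine ⟨i + m, by omega, by omega, ?_⟩
      zify at heq
      rw [hcount_eq_sum, vsum_eq_sum, sum_subpath hE ha hb hhc (by omega) (by omega),
        sum_subpath hE ha hb hvs (by omega) (by omega)] at heq
      omega

end Concrete

/-- **Region of magnitudes of bounded compatible pairs.** -/
theorem bounded_compatible_magnitudes (d1 d2 a1 a2 : ℕ)
    (S1 : Fin a1 → ℕ) (S2 : Fin a2 → ℕ) (hc : Compatible a1 a2 S1 S2)
    (hb1 : ∀ h, S1 h ≤ d1) (hb2 : ∀ v, S2 v ≤ d2) :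
    (d2 * a2 ≤ a1 →
      (∑ v, S2 v) ≤ d2 * a2 ∧ (∑ h, S1 h) ≤ d1 * (a1 - (∑ v, S2 v))) ∧
    (d1 * a1 ≤ a2 →
      (∑ h, S1 h) ≤ d1 * a1 ∧ (∑ v, S2 v) ≤ d2 * (a2 - (∑ h, S1 h))) ∧
    (0 < a1 → a1 < d2 * a2 → 0 < a2 → a2 < d1 * a1 →
      (∑ h, S1 h) ≤ d1 * a1 ∧ (∑ v, S2 v) ≤ d2 * a2 ∧
      (((∑ v, S2 v) < a1 ∧
          (0 < ∑ v, S2 v →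
            a1 * (∑ h, S1 h) < d1 * a1 * (a1 - (∑ v, S2 v)) + a2 * (∑ v, S2 v))) ∨
       ((∑ h, S1 h) < a2 ∧
          (0 < ∑ h, S1 h →
            a2 * (∑ v, S2 v) < d2 * a2 * (a2 - (∑ h, S1 h)) + a1 * (∑ h, S1 h))))) := by
  have hs1 : ∑ h, S1 h ≤ d1 * a1 := by
    simpa [mul_comm] using Finset.sum_le_card_nsmul Finset.univ S1 d1 fun h _ => hb1 h
  have hs2 : ∑ v, S2 v ≤ d2 * a2 := by
    simpa [mul_comm] using Finset.sum_le_card_nsmul Finset.univ S2 d2 fun v _ => hb2 v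
  rcases Nat.eq_zero_or_pos a1 with rfl | ha
  · refine ⟨fun _ => ⟨hs2, by simp⟩, fun _ => ⟨hs1, by simpa using hs2⟩, fun h => by omega⟩
  rcases Nat.eq_zero_or_pos a2 with rfl | hb
  · refine ⟨fun _ => ⟨hs2, by simpa using hs1⟩, fun _ => ⟨hs1, by simp⟩, fun _ _ h => by omega⟩
  obtain ⟨_, _, _, _, w⟩ := exists_isWalk ha hb hc hb1 hb2
  have w' := w.reverse
  have ha' : (0 : ℤ) < a1 := by exact_mod_cast ha
  have hb' : (0 : ℤ) < a2 := by exact_mod_cast hb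
  generalize ∑ h, S1 h = s1 at *
  generalize ∑ v, S2 v = s2 at *
  refine ⟨fun h => ⟨hs2, ?_⟩, fun h => ⟨hs1, ?_⟩, fun _ _ _ _ => ⟨hs1, hs2, ?_⟩⟩
  · have := w.magnitude_le ha' hb' (by exact_mod_cast hs2.trans h) (by exact_mod_cast h)
    zify [hs2.trans h]
    exact this
  · have := w'.magnitude_le hb' ha' (by exact_mod_cast hs1.trans h) (by exact_mod_cast h)
    zify [hs1.trans h]
    exact this
  · by_cases h : s2 < a1
    · refine Or.inl ⟨h, fun h0 => ?_⟩
      have := w.magnitude_lt ha' hb' (by exact_mod_cast h.le) (by exact_mod_cast h0)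
      zify [h.le]
      exact this
    · have h1 : s1 < a2 := by
        rcases (not_lt.1 h).eq_or_lt with rfl | h
        · have := w.magnitude_lt ha' hb' le_rfl ha'
          rw [sub_self, mul_zero, zero_add, mul_comm (a2 : ℤ)] at this
          exact_mod_cast lt_of_mul_lt_mul_left this ha'.le
        · exact_mod_cast w.magnitude_lt_of_lt ha' hb' (by exact_mod_cast h)
      refine Or.inr ⟨h1, fun h0 => ?_⟩
      have := w'.magnitude_lt hb' ha' (by exact_mod_cast h1.le) (by exact_mod_cast h0)
      zify [h1.le]
      exact this

end Dyck
end
end
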